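/- Let X : H ← G and Y : G ← K be groupoid correspondences between étale groupoids. Then the composition X ∘_G Y = (X ×_{s,G⁰,r} Y)/G, with the induced left H-action h·[x,y] = [h·x, y], right K-action [x,y]·k = [x, y·k], and anchor maps r[x,y] = r(x), s[x,y] = s(y), is a groupoid correspondence H ← K. Moreover, if X and Y are both proper (respectively tight), then X ∘_G Y is proper (respectively tight). -/

import Mathlib

open Topology

/-- An étale topological groupoid, given by its arrow space `A` and object space `O`. -/
structure EtaleGroupoid (A O : Type) [TopologicalSpace A] [TopologicalSpace O] where
  r : A → O
  s : A → O
  unit : O → A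
  mul : A → A → A
  inv : A → A
  r_unit : ∀ o, r (unit o) = o
  s_unit : ∀ o, s (unit o) = o
  r_mul : ∀ g h, s g = r h → r (mul g h) = r g
  s_mul : ∀ g h, s g = r h → s (mul g h) = s h
  mul_assoc : ∀ g h k, s g = r h → s h = r k → mul (mul g h) k = mul g (mul h k)
  unit_mul : ∀ g, mul (unit (r g)) g = g
  mul_unit : ∀ g, mul g (unit (s g)) = g
  r_inv : ∀ g, r (inv g) = s g
  s_inv : ∀ g, s (inv g) = r g
  mul_inv : ∀ g, mul g (inv g) = unit (r g)
  inv_mul : ∀ g, mul (inv g) g = unit (s g)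
  etale_r : IsLocalHomeomorph r
  etale_s : IsLocalHomeomorph s
  continuous_mul : Continuous fun p : { p : A × A // s p.1 = r p.2 } => mul p.1.1 p.1.2
  continuous_inv : Continuous inv

variable {A O : Type} [TopologicalSpace A] [TopologicalSpace O]

/-- A right action of an étale groupoid on a topological space `X`. -/
structure RightAction (G : EtaleGroupoid A O) (X : Type) [TopologicalSpace X] where
  anchor : X → O
  act : X → A → X
  continuous_anchor : Continuous anchor
  continuous_act :
    Continuous fun p : { p : X × A // anchor p.1 = G.r p.2 } => act p.1.1 p.1.2
  anchor_act : ∀ x g, anchor x = G.r g → anchor (act x g) = G.s g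
  act_mul : ∀ x g h, anchor x = G.r g → G.s g = G.r h →
    act (act x g) h = act x (G.mul g h)
  act_unit : ∀ x, act x (G.unit (anchor x)) = x

/-- A left action of an étale groupoid on a topological space `X`. -/
structure LeftAction (G : EtaleGroupoid A O) (X : Type) [TopologicalSpace X] where
  anchor : X → O
  act : A → X → X
  continuous_anchor : Continuous anchor
  continuous_act :
    Continuous fun p : { p : A × X // G.s p.1 = anchor p.2 } => act p.1.1 p.1.2
  anchor_act : ∀ g x, G.s g = anchor x → anchor (act g x) = G.r g
  mul_act : ∀ g h x, G.s g = G.r h → G.s h = anchor x →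
    act g (act h x) = act (G.mul g h) x
  unit_act : ∀ x, act (G.unit (anchor x)) x = x

namespace RightAction

variable {G : EtaleGroupoid A O} {X : Type} [TopologicalSpace X]

/-- The map `(x, g) ↦ (x·g, x)` on the fibre product `X ×_{s,G⁰,r} G`. -/
def pairMap (ρ : RightAction G X) :
    { p : X × A // ρ.anchor p.1 = G.r p.2 } → X × X :=
  fun p => (ρ.act p.1.1 p.1.2, p.1.1)

/-- The action is *basic* if `pairMap` is a homeomorphism onto its image. -/
def IsBasic (ρ : RightAction G X) : Prop := Topology.IsEmbedding ρ.pairMap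

/-- The action is *free* if `pairMap` is injective. -/
def IsFree (ρ : RightAction G X) : Prop := Function.Injective ρ.pairMap

/-- The action is *proper* if `pairMap` is a proper map. -/
def IsProper (ρ : RightAction G X) : Prop := IsProperMap ρ.pairMap

/-- Two points are orbit equivalent if one is a translate of the other. -/
def OrbitRel (ρ : RightAction G X) (x y : X) : Prop :=
  ∃ g, ρ.anchor x = G.r g ∧ y = ρ.act x g

/-- The orbit space `X/G`, with the quotient topology. -/
def OrbitSpace (ρ : RightAction G X) : Type := Quot ρ.OrbitRel

instance (ρ : RightAction G X) : TopologicalSpace ρ.OrbitSpace :=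
  instTopologicalSpaceQuot

/-- The orbit space projection `p : X → X/G`. -/
def orbitMap (ρ : RightAction G X) : X → ρ.OrbitSpace := Quot.mk _

end RightAction

variable {AH OH : Type} [TopologicalSpace AH] [TopologicalSpace OH]

/-- A groupoid correspondence `X : H ← G`: commuting left `H`- and right `G`-actions
such that the right anchor map is a local homeomorphism and the right action is free
and proper. -/
structure Correspondence (H : EtaleGroupoid AH OH) (G : EtaleGroupoid A O)
    (X : Type) [TopologicalSpace X] where
  left : LeftAction H X
  right : RightAction G X
  sInv_left : ∀ h x, H.s h = left.anchor x →
    right.anchor (left.act h x) = right.anchor x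
  rInv_right : ∀ x g, right.anchor x = G.r g →
    left.anchor (right.act x g) = left.anchor x
  comm : ∀ h x g, H.s h = left.anchor x → right.anchor x = G.r g →
    left.act h (right.act x g) = right.act (left.act h x) g
  etale_s : IsLocalHomeomorph right.anchor
  free : right.IsFree
  proper : right.IsProper

namespace Correspondence

variable {H : EtaleGroupoid AH OH} {G : EtaleGroupoid A O}
  {X : Type} [TopologicalSpace X]

/-- The map `r_* : X/G → H⁰` induced by the left anchor map. -/
def rStar (C : Correspondence H G X) : C.right.OrbitSpace → OH :=
  Quot.lift C.left.anchor (by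
    rintro x y ⟨g, hg, rfl⟩
    exact (C.rInv_right x g hg).symm)

end Correspondence
section Composition

variable {A O AH OH AK OK : Type} [TopologicalSpace A] [TopologicalSpace O]
  [TopologicalSpace AH] [TopologicalSpace OH]
  [TopologicalSpace AK] [TopologicalSpace OK]
  {H : EtaleGroupoid AH OH} {G : EtaleGroupoid A O} {K : EtaleGroupoid AK OK}
  {X Y : Type} [TopologicalSpace X] [TopologicalSpace Y]

namespace Correspondence

/-- The orbit relation of the diagonal `G`-action `g·(x,y) = (x·g⁻¹, g·y)` on the
fibre product `X ×_{s,G⁰,r} Y` of correspondences `X : H ← G` and `Y : G ← K`. -/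
def diagRel (CX : Correspondence H G X) (CY : Correspondence G K Y) :
    { p : X × Y // CX.right.anchor p.1 = CY.left.anchor p.2 } →
      { p : X × Y // CX.right.anchor p.1 = CY.left.anchor p.2 } → Prop :=
  fun z z' => ∃ g, ∃ hg : CX.right.anchor z.1.1 = G.s g,
    z' = ⟨(CX.right.act z.1.1 (G.inv g), CY.left.act g z.1.2), by
      rw [CX.right.anchor_act _ _ (hg.trans (G.r_inv g).symm), G.s_inv,
        CY.left.anchor_act _ _ (hg.symm.trans z.2)]⟩

/-- The underlying space `X ∘_G Y` of the composite of two groupoid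
correspondences: the orbit space of the diagonal `G`-action. -/
def Comp (CX : Correspondence H G X) (CY : Correspondence G K Y) : Type :=
  Quot (diagRel CX CY)

instance (CX : Correspondence H G X) (CY : Correspondence G K Y) :
    TopologicalSpace (Comp CX CY) := instTopologicalSpaceQuot

/-- The class `[x,y] ∈ X ∘_G Y` of a pair `(x,y)` with `s x = r y`. -/
def compMk (CX : Correspondence H G X) (CY : Correspondence G K Y)
    (z : { p : X × Y // CX.right.anchor p.1 = CY.left.anchor p.2 }) :
    Comp CX CY :=
  Quot.mk _ z

/-- The right anchor map `s[x,y] = s y` of the composite correspondence. -/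
def compAnchorS (CX : Correspondence H G X) (CY : Correspondence G K Y) :
    Comp CX CY → OK :=
  Quot.lift (fun z => CY.right.anchor z.1.2) (by
    rintro z z' ⟨g, hg, rfl⟩
    exact (CY.sInv_left g z.1.2 (hg.symm.trans z.2)).symm)

/-- The left anchor map `r[x,y] = r x` of the composite correspondence. -/
def compAnchorR (CX : Correspondence H G X) (CY : Correspondence G K Y) :
    Comp CX CY → OH :=
  Quot.lift (fun z => CX.left.anchor z.1.1) (by
    rintro z z' ⟨g, hg, rfl⟩
    exact (CX.rInv_right z.1.1 (G.inv g) (hg.trans (G.r_inv g).symm)).symm)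

/-- The orbit relation of the right `K`-action `[x,y]·k = [x, y·k]` on the
composite `X ∘_G Y`, expressed via representatives. -/
def compRightRel (CX : Correspondence H G X) (CY : Correspondence G K Y) :
    Comp CX CY → Comp CX CY → Prop :=
  fun q q' => ∃ z : { p : X × Y // CX.right.anchor p.1 = CY.left.anchor p.2 },
    ∃ k, ∃ hk : CY.right.anchor z.1.2 = K.r k,
      q = compMk CX CY z ∧
      q' = compMk CX CY ⟨(z.1.1, CY.right.act z.1.2 k), by
        rw [CY.rInv_right _ _ hk]; exact z.2⟩

end Correspondence

end Composition

section Helpers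

open Filter

namespace CompAux

/-- Restriction of an open quotient map to a saturated subspace. -/
theorem oqm_restrict {B C : Type*} [TopologicalSpace B] [TopologicalSpace C] {φ : B → C}
    (hφ : IsOpenQuotientMap φ) (P : C → Prop) :
    IsOpenQuotientMap (fun b : { b : B // P (φ b) } => (⟨φ b.1, b.2⟩ : { c : C // P c })) := by
  refine ⟨?_, ?_, ?_⟩
  · rintro ⟨c, hc⟩
    obtain ⟨b, rfl⟩ := hφ.surjective c
    exact ⟨⟨b, hc⟩, rfl⟩
  · exact (hφ.continuous.comp continuous_subtype_val).subtype_mk _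
  · exact hφ.isOpenMap.restrictPreimage {c | P c}

/-- Pullback of an open map is open. -/
theorem pullback_open {B C T : Type*} [TopologicalSpace B] [TopologicalSpace C]
    [TopologicalSpace T] {α : B → T} {β : C → T} (hα : Continuous α) (hβ : IsOpenMap β) :
    IsOpenMap (fun p : { p : B × C // α p.1 = β p.2 } => p.1.1) := by
  refine IsOpenMap.of_nhds_le ?_
  rintro ⟨⟨b, c⟩, h⟩ S hS
  rw [mem_map, nhds_subtype_eq_comap, mem_comap] at hS
  obtain ⟨t, ht, hts⟩ := hS
  obtain ⟨U, hU, V, hV, hUV⟩ := mem_nhds_prod_iff.1 ht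
  have h1 : β '' V ∈ 𝓝 (α b) := by
    have : α b = β c := h
    rw [this]
    exact hβ.image_mem_nhds hV
  filter_upwards [hU, hα.continuousAt.preimage_mem_nhds h1] with b' hb' hb''
  obtain ⟨c', hc', hcc⟩ := hb''
  exact @hts ⟨(b', c'), hcc.symm⟩ (hUV ⟨hb', hc'⟩)

/-- The quotient by an equivalence relation generated by an open action map is an open map. -/
theorem oqm_quot {B C T : Type*} [TopologicalSpace B] [TopologicalSpace C]
    [TopologicalSpace T] {α : B → T} {β : C → T} (hα : Continuous α) (hβ : IsOpenMap β)
    (φ : { p : B × C // α p.1 = β p.2 } → B) (hφ : Continuous φ)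
    (R : B → B → Prop) (hR : Equivalence R)
    (hRφ : ∀ b b', R b b' ↔ ∃ p : { p : B × C // α p.1 = β p.2 }, p.1.1 = b ∧ φ p = b') :
    IsOpenQuotientMap (Quot.mk R) := by
  refine ⟨Quot.mk_surjective, continuous_quot_mk, ?_⟩
  intro U hU
  have : IsOpen (Quot.mk R ⁻¹' (Quot.mk R '' U)) := by
    have h2 : Quot.mk R ⁻¹' (Quot.mk R '' U) =
        (fun p : { p : B × C // α p.1 = β p.2 } => p.1.1) '' (φ ⁻¹' U) := by
      ext b
      constructor
      · rintro ⟨b', hb', e⟩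
        have := (hR.eqvGen_iff).1 (Quot.eqvGen_exact e)
        obtain ⟨p, hp, rfl⟩ := (hRφ _ _).1 (hR.symm this)
        exact ⟨p, hb', hp⟩
      · rintro ⟨p, hp, rfl⟩
        exact ⟨φ p, hp, Quot.sound (hR.symm ((hRφ _ _).2 ⟨p, rfl, rfl⟩))⟩
    rw [h2]
    exact pullback_open hα hβ _ (hU.preimage hφ)
  exact this

/-- Properness descends along open quotient maps. -/
theorem proper_descend {W W' V V' : Type*} [TopologicalSpace W] [TopologicalSpace W']
    [TopologicalSpace V] [TopologicalSpace V'] {p : W → W'} {m : W → V'} {π : V' → V}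
    {f : W' → V} (hp : Continuous p) (hm : IsProperMap m) (hπ : IsOpenQuotientMap π)
    (hf : Continuous f) (comm : ∀ w, f (p w) = π (m w))
    (pb : ∀ w' v', f w' = π v' → ∃ w, p w = w' ∧ m w = v') : IsProperMap f := by
  rw [isProperMap_iff_ultrafilter]
  refine ⟨hf, ?_⟩
  intro 𝒰 v hv
  obtain ⟨v', rfl⟩ := hπ.surjective v
  have ne1 : (comap π (map f 𝒰) ⊓ 𝓝 v').NeBot := by
    rw [inf_comm]
    have : NeBot (map π (𝓝 v') ⊓ map f 𝒰) := by
      rw [hπ.map_nhds_eq, inf_eq_right.2 hv]; infer_instance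
    rw [← Filter.push_pull] at this
    exact this.of_map
  let 𝒱 := @Ultrafilter.of _ _ ne1
  have h𝒱 : (𝒱 : Filter V') ≤ comap π (map f 𝒰) ⊓ 𝓝 v' := @Ultrafilter.of_le _ _ ne1
  have ne2 : (comap p 𝒰 ⊓ comap m 𝒱 : Filter W).NeBot := by
    rw [Filter.inf_neBot_iff]
    rintro s ⟨U, hU, hs⟩ t ⟨V1, hV1, ht⟩
    have : π ⁻¹' (f '' U) ∈ (𝒱 : Filter V') :=
      (h𝒱.trans inf_le_left) (preimage_mem_comap (image_mem_map hU))
    obtain ⟨v1, ⟨w', hw', e⟩, hv1⟩ := (𝒱.neBot.nonempty_of_mem (inter_mem this hV1))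
    obtain ⟨w, rfl, rfl⟩ := pb w' v1 e
    exact ⟨w, hs hw', ht hv1⟩
  let 𝒲 := @Ultrafilter.of _ _ ne2
  have h𝒲 : (𝒲 : Filter W) ≤ comap p 𝒰 ⊓ comap m 𝒱 := @Ultrafilter.of_le _ _ ne2
  have t1 : Tendsto m 𝒲 (𝓝 v') :=
    (tendsto_iff_comap.2 (h𝒲.trans inf_le_right)).mono_right (h𝒱.trans inf_le_right)
  obtain ⟨w, hw, hle⟩ := (isProperMap_iff_ultrafilter.1 hm).2 t1
  have t2 : map p (𝒲 : Filter W) ≤ 𝒰 := map_le_iff_le_comap.2 (h𝒲.trans inf_le_left)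
  have t3 : (𝒰 : Filter W') = map p (𝒲 : Filter W) := by
    have : 𝒲.map p = 𝒰 := Ultrafilter.coe_le_coe.1 t2
    rw [← this]; rfl
  refine ⟨p w, by rw [comm, hw], ?_⟩
  rw [t3]
  exact (hp.tendsto w).mono_left hle

theorem localHomeo_of {B C : Type*} [TopologicalSpace B] [TopologicalSpace C] {f : B → C}
    (hc : Continuous f) (ho : IsOpenMap f) (hi : ∀ b, ∃ U ∈ 𝓝 b, Set.InjOn f U) :
    IsLocalHomeomorph f := by
  rw [isLocalHomeomorph_iff_isOpenEmbedding_restrict]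
  intro b
  obtain ⟨U, hU, hinj⟩ := hi b
  obtain ⟨V, hVU, hV, hb⟩ := mem_nhds_iff.1 hU
  refine ⟨V, hV.mem_nhds hb, ?_⟩
  exact .of_continuous_injective_isOpenMap (hc.comp continuous_subtype_val)
    (Set.injOn_iff_injective.1 (hinj.mono hVU)) (ho.comp hV.isOpenMap_subtype_val)

theorem loc_inj {B C : Type*} [TopologicalSpace B] [TopologicalSpace C] {f : B → C}
    (hf : IsLocalHomeomorph f) (b : B) : ∃ U ∈ 𝓝 b, Set.InjOn f U := by
  obtain ⟨e, he, rfl⟩ := hf b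
  exact ⟨e.source, e.open_source.mem_nhds he, e.injOn⟩

section Actions

variable {A O : Type} [TopologicalSpace A] [TopologicalSpace O] {G : EtaleGroupoid A O}
  {X : Type} [TopologicalSpace X]

theorem ract_tendsto (ρ : RightAction G X) {ι : Type*} {l : Filter ι} {f : ι → X} {g : ι → A}
    {x : X} {a : A} (hf : Tendsto f l (𝓝 x)) (hg : Tendsto g l (𝓝 a))
    (h : ∀ i, ρ.anchor (f i) = G.r (g i)) (h0 : ρ.anchor x = G.r a) :
    Tendsto (fun i => ρ.act (f i) (g i)) l (𝓝 (ρ.act x a)) := by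
  have h1 : Tendsto (fun i => (⟨(f i, g i), h i⟩ : { p : X × A // ρ.anchor p.1 = G.r p.2 })) l
      (𝓝 ⟨(x, a), h0⟩) := tendsto_subtype_rng.2 (hf.prodMk_nhds hg)
  exact (ρ.continuous_act.tendsto _).comp h1

theorem lact_tendsto (ρ : LeftAction G X) {ι : Type*} {l : Filter ι} {f : ι → X} {g : ι → A}
    {x : X} {a : A} (hf : Tendsto f l (𝓝 x)) (hg : Tendsto g l (𝓝 a))
    (h : ∀ i, G.s (g i) = ρ.anchor (f i)) (h0 : G.s a = ρ.anchor x) :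
    Tendsto (fun i => ρ.act (g i) (f i)) l (𝓝 (ρ.act a x)) := by
  have h1 : Tendsto (fun i => (⟨(g i, f i), h i⟩ : { p : A × X // G.s p.1 = ρ.anchor p.2 })) l
      (𝓝 ⟨(a, x), h0⟩) := tendsto_subtype_rng.2 (hg.prodMk_nhds hf)
  exact (ρ.continuous_act.tendsto _).comp h1

theorem ract_cont (ρ : RightAction G X) {ι : Type*} [TopologicalSpace ι] {f : ι → X} {g : ι → A}
    (hf : Continuous f) (hg : Continuous g) (h : ∀ i, ρ.anchor (f i) = G.r (g i)) :
    Continuous (fun i => ρ.act (f i) (g i)) :=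
  continuous_iff_continuousAt.2 fun i => ract_tendsto ρ (hf.tendsto i) (hg.tendsto i) h (h i)

theorem lact_cont (ρ : LeftAction G X) {ι : Type*} [TopologicalSpace ι] {f : ι → X} {g : ι → A}
    (hf : Continuous f) (hg : Continuous g) (h : ∀ i, G.s (g i) = ρ.anchor (f i)) :
    Continuous (fun i => ρ.act (g i) (f i)) :=
  continuous_iff_continuousAt.2 fun i => lact_tendsto ρ (hf.tendsto i) (hg.tendsto i) h (h i)

theorem ract_inv (ρ : RightAction G X) (x : X) (g : A) (h : ρ.anchor x = G.r g) :
    ρ.act (ρ.act x g) (G.inv g) = x := by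
  rw [ρ.act_mul _ _ _ h (G.r_inv g).symm, G.mul_inv, ← h, ρ.act_unit]

theorem ract_inv' (ρ : RightAction G X) (x : X) (g : A) (h : ρ.anchor x = G.s g) :
    ρ.act (ρ.act x (G.inv g)) g = x := by
  rw [ρ.act_mul _ _ _ (h.trans (G.r_inv g).symm) (G.s_inv g), G.inv_mul, ← h, ρ.act_unit]

theorem lact_inv (ρ : LeftAction G X) (x : X) (g : A) (h : G.s g = ρ.anchor x) :
    ρ.act (G.inv g) (ρ.act g x) = x := by
  rw [ρ.mul_act _ _ _ (G.s_inv g) h, G.inv_mul, h, ρ.unit_act]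

theorem orbit_equiv (ρ : RightAction G X) : Equivalence ρ.OrbitRel where
  refl x := ⟨G.unit (ρ.anchor x), (G.r_unit _).symm, (ρ.act_unit x).symm⟩
  symm := by
    rintro x y ⟨g, h, rfl⟩
    refine ⟨G.inv g, ?_, (ract_inv ρ x g h).symm⟩
    rw [ρ.anchor_act _ _ h, G.r_inv]
  trans := by
    rintro x y z ⟨g, h, rfl⟩ ⟨k, h', rfl⟩
    rw [ρ.anchor_act _ _ h] at h'
    exact ⟨G.mul g k, by rw [h, G.r_mul _ _ h'], ρ.act_mul _ _ _ h h'⟩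

theorem orbit_exact (ρ : RightAction G X) {x y : X}
    (h : (Quot.mk _ x : ρ.OrbitSpace) = Quot.mk _ y) : ρ.OrbitRel x y :=
  ((orbit_equiv ρ).eqvGen_iff).1 (Quot.eqvGen_exact h)

theorem orbit_oqm (ρ : RightAction G X) :
    IsOpenQuotientMap (Quot.mk ρ.OrbitRel : X → ρ.OrbitSpace) := by
  refine oqm_quot (α := ρ.anchor) (β := G.r) ρ.continuous_anchor G.etale_r.isOpenMap
    (fun p => ρ.act p.1.1 p.1.2) ρ.continuous_act _ (orbit_equiv ρ) ?_
  intro b b'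
  constructor
  · rintro ⟨g, h, rfl⟩
    exact ⟨⟨(b, g), h⟩, rfl, rfl⟩
  · rintro ⟨⟨⟨b, g⟩, h⟩, rfl, rfl⟩
    exact ⟨g, h, rfl⟩

theorem free_eq {ρ : RightAction G X} (hρ : ρ.IsFree) {x : X} {g g' : A}
    (h : ρ.anchor x = G.r g) (h' : ρ.anchor x = G.r g') (e : ρ.act x g = ρ.act x g') :
    g = g' := by
  have := @hρ ⟨(x, g), h⟩ ⟨(x, g'), h'⟩ (Prod.ext e rfl)
  exact congrArg (fun p => p.1.2) this

/-- Limits of ultrafilters for a proper action. -/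
theorem proper_lim {ρ : RightAction G X} (hρ : ρ.IsProper) {ι : Type*} (𝒰 : Ultrafilter ι)
    {f : ι → X} {g : ι → A} {x y : X} (h : ∀ i, ρ.anchor (f i) = G.r (g i))
    (hf : Tendsto f 𝒰 (𝓝 x)) (hfg : Tendsto (fun i => ρ.act (f i) (g i)) 𝒰 (𝓝 y)) :
    ∃ a, ρ.anchor x = G.r a ∧ ρ.act x a = y ∧ Tendsto g 𝒰 (𝓝 a) := by
  let F : ι → { p : X × A // ρ.anchor p.1 = G.r p.2 } := fun i => ⟨(f i, g i), h i⟩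
  have t : Tendsto ρ.pairMap (𝒰.map F) (𝓝 (y, x)) := hfg.prodMk_nhds hf
  obtain ⟨⟨⟨x1, a⟩, h1⟩, e, hle⟩ := (isProperMap_iff_ultrafilter.1 hρ).2 t
  obtain ⟨e1, e2⟩ := Prod.ext_iff.1 e
  simp only [RightAction.pairMap] at e1 e2
  subst e2
  refine ⟨a, h1, e1, ?_⟩
  have t2 : Tendsto F 𝒰 (𝓝 ⟨(x1, a), h1⟩) := hle
  exact ((continuous_snd.comp continuous_subtype_val).tendsto _).comp t2

end Actions

end CompAux

end Helpers

section Helpers2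

open Filter Correspondence

namespace CompAux

variable {A O AH OH AK OK : Type} [TopologicalSpace A] [TopologicalSpace O]
  [TopologicalSpace AH] [TopologicalSpace OH]
  [TopologicalSpace AK] [TopologicalSpace OK]
  {H : EtaleGroupoid AH OH} {G : EtaleGroupoid A O} {K : EtaleGroupoid AK OK}
  {X Y : Type} [TopologicalSpace X] [TopologicalSpace Y]
  (CX : Correspondence H G X) (CY : Correspondence G K Y)

/-- The fibre product `X ×_{s,G⁰,r} Y`. -/
abbrev FP : Type := { p : X × Y // CX.right.anchor p.1 = CY.left.anchor p.2 }

/-- The class `[x,y]`. -/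
def mk2 (x : X) (y : Y) (h : CX.right.anchor x = CY.left.anchor y) : Comp CX CY :=
  compMk CX CY ⟨(x, y), h⟩

theorem diagRel_iff (z z' : FP CX CY) : diagRel CX CY z z' ↔
    ∃ g, CX.right.anchor z'.1.1 = G.r g ∧ G.s g = CY.left.anchor z.1.2 ∧
      z.1.1 = CX.right.act z'.1.1 g ∧ z'.1.2 = CY.left.act g z.1.2 := by
  constructor
  · rintro ⟨g, hg, rfl⟩
    refine ⟨g, ?_, hg.symm.trans z.2, (ract_inv' _ _ _ hg).symm, rfl⟩
    simp only
    rw [CX.right.anchor_act _ _ (hg.trans (G.r_inv g).symm), G.s_inv]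
  · rintro ⟨g, h1, h2, h3, h4⟩
    refine ⟨g, z.2.trans h2.symm, Subtype.ext (Prod.ext ?_ h4)⟩
    simp only
    rw [h3, ract_inv _ _ _ h1]

theorem diag_equiv : Equivalence (diagRel CX CY) where
  refl := by
    rintro ⟨⟨x, y⟩, h⟩
    simp only at h
    rw [diagRel_iff]
    refine ⟨G.unit (CX.right.anchor x), (G.r_unit _).symm, ?_, (CX.right.act_unit x).symm, ?_⟩
    · rw [G.s_unit]; exact h
    · simp only
      rw [h, CY.left.unit_act]
  symm := by
    intro z z' h
    rw [diagRel_iff] at h ⊢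
    obtain ⟨g, h1, h2, h3, h4⟩ := h
    refine ⟨G.inv g, ?_, ?_, ?_, ?_⟩
    · rw [h3, CX.right.anchor_act _ _ h1, G.r_inv]
    · rw [h4, CY.left.anchor_act _ _ h2, G.s_inv]
    · rw [h3, ract_inv _ _ _ h1]
    · rw [h4, lact_inv _ _ _ h2]
  trans := by
    intro z z' z'' h h'
    rw [diagRel_iff] at h h' ⊢
    obtain ⟨g, h1, h2, h3, h4⟩ := h
    obtain ⟨k, k1, k2, k3, k4⟩ := h'
    have e : G.s k = G.r g := by
      rw [k2, h4, CY.left.anchor_act _ _ h2]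
    refine ⟨G.mul k g, ?_, ?_, ?_, ?_⟩
    · rw [k1, G.r_mul _ _ e]
    · rw [G.s_mul _ _ e, h2]
    · rw [h3, k3, CX.right.act_mul _ _ _ k1 e]
    · rw [k4, h4, CY.left.mul_act _ _ _ e h2]

theorem comp_exact {z z' : FP CX CY} (h : compMk CX CY z = compMk CX CY z') :
    ∃ g, CX.right.anchor z'.1.1 = G.r g ∧ G.s g = CY.left.anchor z.1.2 ∧
      z.1.1 = CX.right.act z'.1.1 g ∧ z'.1.2 = CY.left.act g z.1.2 :=
  (diagRel_iff CX CY z z').1 (((diag_equiv CX CY).eqvGen_iff).1 (Quot.eqvGen_exact h))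

theorem comp_sound {z z' : FP CX CY} (g : A) (h1 : CX.right.anchor z'.1.1 = G.r g)
    (h2 : G.s g = CY.left.anchor z.1.2) (h3 : z.1.1 = CX.right.act z'.1.1 g)
    (h4 : z'.1.2 = CY.left.act g z.1.2) : compMk CX CY z = compMk CX CY z' :=
  Quot.sound ((diagRel_iff CX CY z z').2 ⟨g, h1, h2, h3, h4⟩)

theorem comp_oqm : IsOpenQuotientMap (compMk CX CY) := by
  refine oqm_quot (B := FP CX CY) (α := fun z => CX.right.anchor z.1.1) (β := G.s)
    (CX.right.continuous_anchor.comp (continuous_fst.comp continuous_subtype_val))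
    G.etale_s.isOpenMap
    (fun p => ⟨(CX.right.act p.1.1.1.1 (G.inv p.1.2), CY.left.act p.1.2 p.1.1.1.2), ?_⟩) ?_ _
    (diag_equiv CX CY) ?_
  · rw [CX.right.anchor_act _ _ (p.2.trans (G.r_inv p.1.2).symm), G.s_inv,
        CY.left.anchor_act _ _ (p.2.symm.trans p.1.1.2)]
  · refine Continuous.subtype_mk (Continuous.prodMk ?_ ?_) _
    · refine ract_cont CX.right (by fun_prop) (G.continuous_inv.comp (by fun_prop)) ?_
      intro p
      exact (p.2.trans (G.r_inv p.1.2).symm)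
    · refine lact_cont CY.left (by fun_prop) (by fun_prop) ?_
      intro p
      exact (p.2.symm.trans p.1.1.2)
  · intro b b'
    constructor
    · rintro ⟨g, h, rfl⟩
      exact ⟨⟨(b, g), h⟩, rfl, rfl⟩
    · rintro ⟨⟨⟨b, g⟩, h⟩, rfl, rfl⟩
      exact ⟨g, h, rfl⟩

theorem cont_S : Continuous (compAnchorS CX CY) :=
  (comp_oqm CX CY).continuous_comp_iff.1
    (CY.right.continuous_anchor.comp (continuous_snd.comp continuous_subtype_val))

theorem cont_R : Continuous (compAnchorR CX CY) :=
  (comp_oqm CX CY).continuous_comp_iff.1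
    (CX.left.continuous_anchor.comp (continuous_fst.comp continuous_subtype_val))

theorem etale_S : IsLocalHomeomorph (compAnchorS CX CY) := by
  have hq := comp_oqm CX CY
  have op : IsOpenMap (fun z : FP CX CY => z.1.2) := by
    intro U hU
    let e : { p : Y × X // CY.left.anchor p.1 = CX.right.anchor p.2 } → FP CX CY :=
      fun p => ⟨(p.1.2, p.1.1), p.2.symm⟩
    have he : Continuous e := by
      refine Continuous.subtype_mk (Continuous.prodMk ?_ ?_) _ <;> fun_prop
    have := pullback_open CY.left.continuous_anchor CX.etale_s.isOpenMap _ (hU.preimage he)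
    convert this using 1
    ext y
    constructor
    · rintro ⟨⟨⟨x, y⟩, h⟩, hz, rfl⟩
      exact ⟨⟨(y, x), h.symm⟩, hz, rfl⟩
    · rintro ⟨⟨⟨y, x⟩, h⟩, hz, rfl⟩
      exact ⟨_, hz, rfl⟩
  refine localHomeo_of (cont_S CX CY) ?_ ?_
  · rw [hq.isOpenMap_iff]
    exact CY.etale_s.isOpenMap.comp op
  · intro q
    obtain ⟨⟨⟨x, y⟩, h⟩, rfl⟩ := hq.surjective q
    obtain ⟨U, hU, iU⟩ := loc_inj CX.etale_s x
    obtain ⟨V, hV, iV⟩ := loc_inj CY.etale_s y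
    refine ⟨compMk CX CY '' {z | z.1.1 ∈ U ∧ z.1.2 ∈ V}, hq.isOpenMap.image_mem_nhds ?_, ?_⟩
    · have c1 : Tendsto (fun z : FP CX CY => z.1.1) (𝓝 ⟨(x, y), h⟩) (𝓝 x) :=
        (continuous_fst.comp continuous_subtype_val).tendsto _
      have c2 : Tendsto (fun z : FP CX CY => z.1.2) (𝓝 ⟨(x, y), h⟩) (𝓝 y) :=
        (continuous_snd.comp continuous_subtype_val).tendsto _
      exact inter_mem (c1 hU) (c2 hV)
    · rintro _ ⟨⟨⟨x1, y1⟩, h1⟩, ⟨hx1, hy1⟩, rfl⟩ _ ⟨⟨⟨x2, y2⟩, h2⟩, ⟨hx2, hy2⟩, rfl⟩ e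
      simp only at hx1 hy1 hx2 hy2 h1 h2
      have e1 : y1 = y2 := iV hy1 hy2 e
      subst e1
      have e2 : x1 = x2 := iU hx1 hx2 (h1.trans h2.symm)
      subst e2
      rfl

open Classical in
/-- The left action on the composite. -/
noncomputable def lact (h : AH) : Comp CX CY → Comp CX CY :=
  Quot.lift (fun z : FP CX CY => if hh : H.s h = CX.left.anchor z.1.1 then
    compMk CX CY ⟨(CX.left.act h z.1.1, z.1.2), by rw [CX.sInv_left _ _ hh]; exact z.2⟩
    else compMk CX CY z) (by
    intro z z' hz
    obtain ⟨g, h1, h2, h3, h4⟩ := (diagRel_iff CX CY z z').1 hz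
    have e : CX.left.anchor z.1.1 = CX.left.anchor z'.1.1 := by
      rw [h3, CX.rInv_right _ _ h1]
    by_cases hh : H.s h = CX.left.anchor z.1.1
    · have hh' := hh.trans e
      rw [dif_pos hh, dif_pos hh']
      refine comp_sound CX CY g ?_ h2 ?_ h4
      · simp only
        rw [CX.sInv_left _ _ hh', h1]
      · simp only
        rw [h3, CX.comm _ _ _ hh' h1]
    · rw [dif_neg hh, dif_neg (fun h' => hh (h'.trans e.symm))]
      exact Quot.sound hz)

open Classical in
/-- The right action on the composite. -/
noncomputable def ract (q : Comp CX CY) (k : AK) : Comp CX CY :=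
  Quot.lift (fun z : FP CX CY => if hk : CY.right.anchor z.1.2 = K.r k then
    compMk CX CY ⟨(z.1.1, CY.right.act z.1.2 k), by rw [CY.rInv_right _ _ hk]; exact z.2⟩
    else compMk CX CY z) (by
    intro z z' hz
    obtain ⟨g, h1, h2, h3, h4⟩ := (diagRel_iff CX CY z z').1 hz
    have e : CY.right.anchor z.1.2 = CY.right.anchor z'.1.2 := by
      rw [h4, CY.sInv_left _ _ h2]
    by_cases hk : CY.right.anchor z.1.2 = K.r k
    · have hk' := e.symm.trans hk
      rw [dif_pos hk, dif_pos hk']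
      refine comp_sound CX CY g h1 ?_ h3 ?_
      · simp only
        rw [CY.rInv_right _ _ hk, h2]
      · simp only
        rw [h4, CY.comm _ _ _ h2 hk]
    · rw [dif_neg hk, dif_neg (fun h' => hk (e.trans h'))]
      exact Quot.sound hz) q

theorem lact_mk (z : FP CX CY) (h : AH) (hh : H.s h = CX.left.anchor z.1.1) :
    lact CX CY h (compMk CX CY z) =
      compMk CX CY ⟨(CX.left.act h z.1.1, z.1.2), by
        rw [CX.sInv_left _ _ hh]; exact z.2⟩ := dif_pos hh

theorem ract_mk (z : FP CX CY) (k : AK) (hk : CY.right.anchor z.1.2 = K.r k) :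
    ract CX CY (compMk CX CY z) k =
      compMk CX CY ⟨(z.1.1, CY.right.act z.1.2 k), by
        rw [CY.rInv_right _ _ hk]; exact z.2⟩ := dif_pos hk

/-- The left action. -/
noncomputable def leftA : LeftAction H (Comp CX CY) where
  anchor := compAnchorR CX CY
  act := lact CX CY
  continuous_anchor := cont_R CX CY
  continuous_act := by
    have hq := oqm_restrict (IsOpenQuotientMap.id.prodMap (comp_oqm CX CY))
      (fun p : AH × Comp CX CY => H.s p.1 = compAnchorR CX CY p.2)
    rw [← hq.continuous_comp_iff]
    have hc : Continuous (fun p : { p : AH × FP CX CY // H.s p.1 = CX.left.anchor p.2.1.1 } =>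
        compMk CX CY ⟨(CX.left.act p.1.1 p.1.2.1.1, p.1.2.1.2), by
          rw [CX.sInv_left _ _ p.2]; exact p.1.2.2⟩) := by
      refine (comp_oqm CX CY).continuous.comp
        (Continuous.subtype_mk (Continuous.prodMk ?_ ?_) _)
      · exact lact_cont CX.left (by fun_prop) (by fun_prop) fun p => p.2
      · fun_prop
    exact hc.congr fun p => (lact_mk CX CY p.1.2 p.1.1 p.2).symm
  anchor_act := by
    intro h q hh
    obtain ⟨z, rfl⟩ := (comp_oqm CX CY).surjective q
    rw [lact_mk CX CY z h hh]
    exact CX.left.anchor_act _ _ hh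
  mul_act := by
    intro g h q e hh
    obtain ⟨z, rfl⟩ := (comp_oqm CX CY).surjective q
    have hh' : H.s h = CX.left.anchor z.1.1 := hh
    rw [lact_mk CX CY z h hh, lact_mk, lact_mk]
    · congr 3
      exact CX.left.mul_act _ _ _ e hh
    · rw [H.s_mul _ _ e]; exact hh
    · simp only
      rw [CX.left.anchor_act _ _ hh', e]
  unit_act := by
    intro q
    obtain ⟨z, rfl⟩ := (comp_oqm CX CY).surjective q
    refine (lact_mk CX CY z _ (H.s_unit _)).trans (congrArg (compMk CX CY) ?_)
    exact Subtype.ext (Prod.ext (CX.left.unit_act _) rfl)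

/-- The right action. -/
noncomputable def rightA : RightAction K (Comp CX CY) where
  anchor := compAnchorS CX CY
  act := ract CX CY
  continuous_anchor := cont_S CX CY
  continuous_act := by
    have hq := oqm_restrict ((comp_oqm CX CY).prodMap IsOpenQuotientMap.id)
      (fun p : Comp CX CY × AK => compAnchorS CX CY p.1 = K.r p.2)
    rw [← hq.continuous_comp_iff]
    have hc : Continuous (fun p : { p : FP CX CY × AK // CY.right.anchor p.1.1.2 = K.r p.2 } =>
        compMk CX CY ⟨(p.1.1.1.1, CY.right.act p.1.1.1.2 p.1.2), by
          rw [CY.rInv_right _ _ p.2]; exact p.1.1.2⟩) := by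
      refine (comp_oqm CX CY).continuous.comp
        (Continuous.subtype_mk (Continuous.prodMk ?_ ?_) _)
      · fun_prop
      · exact ract_cont CY.right (by fun_prop) (by fun_prop) fun p => p.2
    exact hc.congr fun p => (ract_mk CX CY p.1.1 p.1.2 p.2).symm
  anchor_act := by
    intro q k hk
    obtain ⟨z, rfl⟩ := (comp_oqm CX CY).surjective q
    rw [ract_mk CX CY z k hk]
    exact CY.right.anchor_act _ _ hk
  act_mul := by
    intro q k l hk e
    obtain ⟨z, rfl⟩ := (comp_oqm CX CY).surjective q
    have hk' : CY.right.anchor z.1.2 = K.r k := hk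
    rw [ract_mk CX CY z k hk, ract_mk, ract_mk]
    · congr 3
      exact CY.right.act_mul _ _ _ hk e
    · rw [K.r_mul _ _ e]; exact hk
    · simp only
      rw [CY.right.anchor_act _ _ hk', e]
  act_unit := by
    intro q
    obtain ⟨z, rfl⟩ := (comp_oqm CX CY).surjective q
    refine (ract_mk CX CY z _ (K.r_unit _).symm).trans (congrArg (compMk CX CY) ?_)
    exact Subtype.ext (Prod.ext rfl (CY.right.act_unit _))

theorem rightA_free : (rightA CX CY).IsFree := by
  rintro ⟨⟨q, k⟩, hk⟩ ⟨⟨q', k'⟩, hk'⟩ e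
  obtain ⟨e1, e2⟩ := Prod.ext_iff.1 e
  simp only [RightAction.pairMap] at e1 e2
  subst e2
  obtain ⟨⟨⟨x, y⟩, h⟩, rfl⟩ := (comp_oqm CX CY).surjective q
  have hy : CY.right.anchor y = K.r k := hk
  have hy' : CY.right.anchor y = K.r k' := hk'
  simp only at h
  have e3 := (ract_mk CX CY ⟨(x, y), h⟩ k hk).symm.trans
    (e1.trans (ract_mk CX CY ⟨(x, y), h⟩ k' hk'))
  obtain ⟨g, h1, h2, h3, h4⟩ := comp_exact CX CY e3
  simp only at h1 h2 h3 h4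
  have hg : g = G.unit (CX.right.anchor x) := by
    refine free_eq CX.free h1 (G.r_unit _).symm ?_
    rw [← h3, CX.right.act_unit]
  have hk2 : k' = k := by
    refine free_eq CY.free hy' hy ?_
    rw [h4, hg, h, ← CY.rInv_right _ _ hy, CY.left.unit_act]
  subst hk2
  rfl

/-- The space of `(g, (x,y), k)`. -/
abbrev WP : Type := { w : A × FP CX CY × AK //
  CX.right.anchor w.2.1.1.1 = G.s w.1 ∧ CY.right.anchor w.2.1.1.2 = K.r w.2.2 }

theorem wp_anchor (w : WP CX CY) : CX.right.anchor w.1.2.1.1.1 = G.r (G.inv w.1.1) :=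
  w.2.1.trans (G.r_inv _).symm

theorem wp_anchor2 (w : WP CX CY) : G.s w.1.1 = CY.left.anchor w.1.2.1.1.2 :=
  w.2.1.symm.trans w.1.2.1.2

theorem wp_anchor3 (w : WP CX CY) :
    CY.right.anchor (CY.left.act w.1.1 w.1.2.1.1.2) = K.r w.1.2.2 := by
  rw [CY.sInv_left _ _ (wp_anchor2 CX CY w), w.2.2]

/-- The map `(g,(x,y),k) ↦ ((x g⁻¹, g y k), (x, y))`. -/
def wmap (w : WP CX CY) : FP CX CY × FP CX CY :=
  (⟨(CX.right.act w.1.2.1.1.1 (G.inv w.1.1),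
      CY.right.act (CY.left.act w.1.1 w.1.2.1.1.2) w.1.2.2), by
    rw [CX.right.anchor_act _ _ (wp_anchor CX CY w), G.s_inv,
      CY.rInv_right _ _ (wp_anchor3 CX CY w), CY.left.anchor_act _ _ (wp_anchor2 CX CY w)]⟩,
   w.1.2.1)

theorem inv_inv' (g : A) : G.inv (G.inv g) = g := by
  have h1 : G.mul (G.mul g (G.inv g)) (G.inv (G.inv g)) = g := by
    rw [G.mul_assoc _ _ _ (G.r_inv g).symm (G.r_inv _).symm, G.mul_inv, G.r_inv, G.mul_unit]
  rw [G.mul_inv] at h1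
  have h2 := G.unit_mul (G.inv (G.inv g))
  rw [G.r_inv, G.s_inv] at h2
  rw [← h2, h1]

theorem wmap_proper : IsProperMap (wmap CX CY) := by
  rw [isProperMap_iff_ultrafilter]
  constructor
  · have c : Continuous (fun w : WP CX CY => CY.left.act w.1.1 w.1.2.1.1.2) :=
      lact_cont CY.left (by fun_prop) (by fun_prop) (wp_anchor2 CX CY)
    refine Continuous.prodMk (Continuous.subtype_mk (Continuous.prodMk ?_ ?_) _) (by fun_prop)
    · exact ract_cont CX.right (by fun_prop) (G.continuous_inv.comp (by fun_prop))
        (wp_anchor CX CY)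
    · exact ract_cont CY.right c (by fun_prop) (wp_anchor3 CX CY)
  · rintro 𝒰 ⟨⟨⟨x', y'⟩, h'⟩, ⟨⟨x, y⟩, h⟩⟩ ht
    simp only at h h'
    have c11 : Continuous (fun v : FP CX CY × FP CX CY => v.1.1.1) := by fun_prop
    have c12 : Continuous (fun v : FP CX CY × FP CX CY => v.1.1.2) := by fun_prop
    have c21 : Continuous (fun v : FP CX CY × FP CX CY => v.2.1.1) := by fun_prop
    have c22 : Continuous (fun v : FP CX CY × FP CX CY => v.2.1.2) := by fun_prop
    have t11 := (c11.tendsto _).comp ht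
    have t12 := (c12.tendsto _).comp ht
    have t21 := (c21.tendsto _).comp ht
    have t22 := (c22.tendsto _).comp ht
    obtain ⟨a, ha, hax, hta⟩ := proper_lim CX.proper 𝒰 (f := fun w : WP CX CY => w.1.2.1.1.1)
      (g := fun w => G.inv w.1.1) (wp_anchor CX CY) t21 t11
    simp only at ha hax
    have tg : Tendsto (fun w : WP CX CY => w.1.1) 𝒰 (𝓝 (G.inv a)) := by
      have := (G.continuous_inv.tendsto a).comp hta
      refine this.congr fun w => ?_
      exact inv_inv' _
    have hay : G.s (G.inv a) = CY.left.anchor y := by rw [G.s_inv, ← ha, h]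
    have tgy := lact_tendsto CY.left t22 tg (wp_anchor2 CX CY) hay
    obtain ⟨k, hk, hky, htk⟩ := proper_lim CY.proper 𝒰
      (f := fun w : WP CX CY => CY.left.act w.1.1 w.1.2.1.1.2)
      (g := fun w => w.1.2.2) (wp_anchor3 CX CY) tgy t12
    simp only at hk hky
    have hw : CX.right.anchor x = G.s (G.inv a) ∧ CY.right.anchor y = K.r k :=
      ⟨by rw [G.s_inv, ha], by rw [← hk, CY.sInv_left _ _ hay]⟩
    refine ⟨⟨(G.inv a, ⟨(x, y), h⟩, k), hw⟩, ?_, ?_⟩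
    · refine Prod.ext (Subtype.ext (Prod.ext ?_ ?_)) rfl
      · simp only [wmap]
        rw [inv_inv', hax]
      · exact hky
    · have tz : Tendsto (fun w : WP CX CY => w.1.2.1) 𝒰 (𝓝 ⟨(x, y), h⟩) :=
        (continuous_snd.tendsto _).comp ht
      have : Tendsto (fun w : WP CX CY => w) 𝒰 (𝓝 ⟨(G.inv a, ⟨(x, y), h⟩, k), hw⟩) :=
        tendsto_subtype_rng.2 (tg.prodMk_nhds (tz.prodMk_nhds htk))
      exact this

theorem rightA_proper : (rightA CX CY).IsProper := by
  have hq := comp_oqm CX CY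
  refine proper_descend (W := WP CX CY) (m := wmap CX CY)
    (p := fun w => ⟨(compMk CX CY w.1.2.1, w.1.2.2), w.2.2⟩)
    (π := Prod.map (compMk CX CY) (compMk CX CY)) ?_ (wmap_proper CX CY) (hq.prodMap hq) ?_ ?_ ?_
  · exact Continuous.subtype_mk
      (Continuous.prodMk (hq.continuous.comp (by fun_prop)) (by fun_prop)) _
  · exact Continuous.prodMk (rightA CX CY).continuous_act
      (continuous_fst.comp continuous_subtype_val)
  · rintro w
    refine Prod.ext ?_ rfl
    refine (ract_mk CX CY w.1.2.1 w.1.2.2 w.2.2).trans ?_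
    refine comp_sound CX CY w.1.1 ?_ ?_ ?_ ?_
    · simp only [wmap]
      rw [CX.right.anchor_act _ _ (wp_anchor CX CY w), G.s_inv]
    · simp only
      rw [CY.rInv_right _ _ w.2.2]; exact wp_anchor2 CX CY w
    · exact (ract_inv' _ _ _ w.2.1).symm
    · exact (CY.comm _ _ _ (wp_anchor2 CX CY w) w.2.2).symm
  · rintro ⟨⟨q, k⟩, hk⟩ ⟨z', z⟩ e
    obtain ⟨e1, e2⟩ := Prod.ext_iff.1 e
    simp only [RightAction.pairMap, Prod.map] at e1 e2
    subst e2
    have hk' : CY.right.anchor z.1.2 = K.r k := hk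
    have e3 := (ract_mk CX CY z k hk).symm.trans e1
    obtain ⟨g, h1, h2, h3, h4⟩ := comp_exact CX CY e3
    simp only at h1 h2 h3 h4
    rw [CY.rInv_right _ _ hk'] at h2
    refine ⟨⟨(g, z, k), z.2.trans h2.symm, hk⟩, rfl, ?_⟩
    refine Prod.ext (Subtype.ext (Prod.ext ?_ ?_)) rfl
    · simp only [wmap]
      rw [h3, ract_inv _ _ _ h1]
    · simp only [wmap]
      rw [h4, CY.comm _ _ _ h2 hk']

/-- The composite correspondence. -/
noncomputable def compC : Correspondence H K (Comp CX CY) where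
  left := leftA CX CY
  right := rightA CX CY
  sInv_left := by
    intro h q hh
    obtain ⟨z, rfl⟩ := (comp_oqm CX CY).surjective q
    exact congrArg (compAnchorS CX CY) (lact_mk CX CY z h hh)
  rInv_right := by
    intro q k hk
    obtain ⟨z, rfl⟩ := (comp_oqm CX CY).surjective q
    exact congrArg (compAnchorR CX CY) (ract_mk CX CY z k hk)
  comm := by
    intro h q k hh hk
    obtain ⟨z, rfl⟩ := (comp_oqm CX CY).surjective q
    change lact CX CY h (ract CX CY (compMk CX CY z) k) =
      ract CX CY (lact CX CY h (compMk CX CY z)) k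
    rw [ract_mk CX CY z k hk, lact_mk CX CY z h hh, lact_mk, ract_mk]
    · exact hk
    · exact hh
  etale_s := etale_S CX CY
  free := rightA_free CX CY
  proper := rightA_proper CX CY

/-- The map `(X ∘ Y)/K → X/G`. -/
def toXG : (compC CX CY).right.OrbitSpace → CX.right.OrbitSpace :=
  Quot.lift (Quot.lift (fun z : FP CX CY => (Quot.mk _ z.1.1 : CX.right.OrbitSpace)) (by
    intro z z' hz
    obtain ⟨g, h1, h2, h3, h4⟩ := (diagRel_iff CX CY z z').1 hz
    exact (Quot.sound ⟨g, h1, h3⟩ : Quot.mk CX.right.OrbitRel z'.1.1 = Quot.mk _ z.1.1).symm))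
    (by
      rintro q _ ⟨k, hk, rfl⟩
      obtain ⟨z, rfl⟩ := (comp_oqm CX CY).surjective q
      have := ract_mk CX CY z k hk
      change _ = Quot.lift _ _ (ract CX CY (compMk CX CY z) k)
      rw [this]
      rfl)

/-- The class of `(x,y)` in `(X ∘ Y)/K`. -/
def mkO (z : FP CX CY) : (compC CX CY).right.OrbitSpace := Quot.mk _ (compMk CX CY z)

theorem mkO_oqm : IsOpenQuotientMap (mkO CX CY) :=
  (orbit_oqm (compC CX CY).right).comp (comp_oqm CX CY)

theorem mkO_eq {z z' : FP CX CY} (g : A) (k : AK) (h1 : CX.right.anchor z'.1.1 = G.r g)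
    (h2 : G.s g = CY.left.anchor z.1.2) (h3 : z.1.1 = CX.right.act z'.1.1 g)
    (hk : CY.right.anchor (CY.left.act g z.1.2) = K.r k)
    (h4 : z'.1.2 = CY.right.act (CY.left.act g z.1.2) k) : mkO CX CY z = mkO CX CY z' := by
  have hk' : CY.right.anchor z.1.2 = K.r k := by rw [← hk, CY.sInv_left _ _ h2]
  refine Quot.sound ⟨k, hk', ?_⟩
  refine Eq.trans ?_ (ract_mk CX CY z k hk').symm
  symm
  refine comp_sound CX CY g h1 ?_ h3 ?_
  · simp only
    rw [CY.rInv_right _ _ hk', h2]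
  · rw [h4, CY.comm _ _ _ h2 hk']

/-- The fibre product `X ×_{s,G⁰,r} Y/K`. -/
abbrev XYK : Type := { p : X × CY.right.OrbitSpace // CX.right.anchor p.1 = CY.rStar p.2 }

/-- The map `X ×_{G⁰} Y/K → (X ∘ Y)/K`. -/
noncomputable def fromXYK (p : XYK CX CY) : (compC CX CY).right.OrbitSpace :=
  mkO CX CY ⟨(p.1.1, p.1.2.out), by
    have h := p.2
    rw [← Quot.out_eq p.1.2] at h
    exact h⟩

theorem fromXYK_mk (x : X) (y : Y) (h : CX.right.anchor x = CY.left.anchor y) :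
    fromXYK CX CY ⟨(x, Quot.mk _ y), h⟩ = mkO CX CY ⟨(x, y), h⟩ := by
  obtain ⟨k, hk, e⟩ := orbit_exact CY.right
    (Quot.out_eq (Quot.mk CY.right.OrbitRel y : CY.right.OrbitSpace))
  have hy' : CX.right.anchor x = CY.left.anchor
      (Quot.out (Quot.mk CY.right.OrbitRel y : CY.right.OrbitSpace)) := by
    rw [h]
    conv_lhs => rw [e]
    rw [CY.rInv_right _ _ hk]
  have e3 := CY.left.unit_act (Quot.out (Quot.mk CY.right.OrbitRel y : CY.right.OrbitSpace))
  rw [← hy'] at e3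
  refine mkO_eq CX CY (G.unit (CX.right.anchor x)) k (G.r_unit _).symm ?_
    (CX.right.act_unit x).symm ?_ ?_
  · rw [G.s_unit]; exact hy'
  · exact (congrArg _ e3).trans hk
  · exact e.trans (congrArg (fun t => CY.right.act t k) e3.symm)

theorem fromXYK_cont : Continuous (fromXYK CX CY) := by
  have hq : IsOpenQuotientMap
      (fun b : FP CX CY => (⟨(b.1.1, Quot.mk _ b.1.2), b.2⟩ : XYK CX CY)) :=
    oqm_restrict (IsOpenQuotientMap.id.prodMap (orbit_oqm CY.right))
      (fun p : X × CY.right.OrbitSpace => CX.right.anchor p.1 = CY.rStar p.2)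
  rw [← hq.continuous_comp_iff]
  exact (mkO_oqm CX CY).continuous.congr fun z => (fromXYK_mk CX CY z.1.1 z.1.2 z.2).symm

theorem toXG_proper (hY : IsProperMap CY.rStar) : IsProperMap (toXG CX CY) := by
  have hm : IsProperMap (fun p : XYK CX CY => p.1.1) := by
    rw [isProperMap_iff_ultrafilter]
    refine ⟨by fun_prop, ?_⟩
    intro 𝒰 x hx
    have t0 : Tendsto (fun p : XYK CX CY => CY.rStar p.1.2) 𝒰 (𝓝 (CX.right.anchor x)) := by
      have := (CX.right.continuous_anchor.tendsto x).comp hx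
      exact this.congr fun p : XYK CX CY => p.2
    have t : Tendsto CY.rStar (𝒰.map (fun p : XYK CX CY => p.1.2)) (𝓝 (CX.right.anchor x)) := t0
    obtain ⟨η, hη, hle⟩ := (isProperMap_iff_ultrafilter.1 hY).2 t
    refine ⟨⟨(x, η), hη.symm⟩, rfl, ?_⟩
    have : Tendsto (fun w : XYK CX CY => w) 𝒰 (𝓝 ⟨(x, η), hη.symm⟩) :=
      tendsto_subtype_rng.2 (Tendsto.prodMk_nhds hx hle)
    exact this
  refine proper_descend (fromXYK_cont CX CY) hm (orbit_oqm CX.right) ?_ ?_ ?_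
  · rw [← (mkO_oqm CX CY).continuous_comp_iff]
    exact (orbit_oqm CX.right).continuous.comp (continuous_fst.comp continuous_subtype_val)
  · intro w
    rfl
  · intro w' x e
    obtain ⟨⟨⟨x', y'⟩, h⟩, rfl⟩ := (mkO_oqm CX CY).surjective w'
    simp only at h
    obtain ⟨g, hg, rfl⟩ := orbit_exact CX.right (e.symm : Quot.mk _ x = Quot.mk _ x')
    have hs : G.s g = CY.left.anchor y' := by rw [← h, CX.right.anchor_act _ _ hg]
    have h2 : CX.right.anchor x = CY.left.anchor (CY.left.act g y') := by
      rw [CY.left.anchor_act _ _ hs, hg]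
    refine ⟨⟨(x, Quot.mk _ (CY.left.act g y')), h2⟩, ?_, rfl⟩
    rw [fromXYK_mk CX CY _ _ h2]
    exact congrArg (Quot.mk _) (comp_sound CX CY g hg hs rfl rfl).symm

theorem rStar_factor : (compC CX CY).rStar = CX.rStar ∘ toXG CX CY := by
  funext q
  obtain ⟨z, rfl⟩ := (mkO_oqm CX CY).surjective q
  rfl

theorem rStar_proper (hX : IsProperMap CX.rStar) (hY : IsProperMap CY.rStar) :
    IsProperMap (compC CX CY).rStar := by
  rw [rStar_factor]
  exact hX.comp (toXG_proper CX CY hY)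

theorem rStar_homeo (hX : IsHomeomorph CX.rStar) (hY : IsHomeomorph CY.rStar) :
    IsHomeomorph (compC CX CY).rStar := by
  have hp := rStar_proper CX CY hX.isProperMap hY.isProperMap
  rw [isHomeomorph_iff_continuous_isClosedMap_bijective]
  refine ⟨hp.continuous, hp.isClosedMap, ?_, ?_⟩
  · intro q q' e
    obtain ⟨⟨⟨x, y⟩, h⟩, rfl⟩ := (mkO_oqm CX CY).surjective q
    obtain ⟨⟨⟨x', y'⟩, h'⟩, rfl⟩ := (mkO_oqm CX CY).surjective q'
    simp only at h h'
    have e1 : (Quot.mk _ x' : CX.right.OrbitSpace) = Quot.mk _ x := hX.bijective.1 e.symm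
    obtain ⟨g, hg, rfl⟩ := orbit_exact CX.right e1
    have hs : G.s g = CY.left.anchor y := by rw [← h, CX.right.anchor_act _ _ hg]
    have e2 : (Quot.mk _ (CY.left.act g y) : CY.right.OrbitSpace) = Quot.mk _ y' := by
      refine hY.bijective.1 ?_
      change CY.left.anchor _ = CY.left.anchor _
      rw [CY.left.anchor_act _ _ hs, ← hg, h']
    obtain ⟨k, hk, e3⟩ := orbit_exact CY.right e2
    exact mkO_eq CX CY g k hg hs rfl hk e3
  · intro o
    obtain ⟨ξ, rfl⟩ := hX.bijective.2 o
    obtain ⟨x, rfl⟩ := Quot.mk_surjective ξ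
    obtain ⟨η, hη⟩ := hY.bijective.2 (CX.right.anchor x)
    obtain ⟨y, rfl⟩ := Quot.mk_surjective η
    exact ⟨mkO CX CY ⟨(x, y), hη.symm⟩, rfl⟩

end CompAux

end Helpers2

section Statement13

open Correspondence

/-- The composition `X ∘_G Y = (X ×_{s,G⁰,r} Y)/G` of groupoid correspondences
`X : H ← G` and `Y : G ← K`, with left `H`-action `h·[x,y] = [h·x, y]`, right
`K`-action `[x,y]·k = [x, y·k]` and anchor maps `r[x,y] = r x`, `s[x,y] = s y`,
is a groupoid correspondence `H ← K`.  Moreover, if `X` and `Y` are both proper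
(respectively tight), then so is `X ∘_G Y`. -/
theorem composition_is_correspondence
    {A O AH OH AK OK : Type} [TopologicalSpace A] [TopologicalSpace O]
    [TopologicalSpace AH] [TopologicalSpace OH]
    [TopologicalSpace AK] [TopologicalSpace OK]
    {H : EtaleGroupoid AH OH} {G : EtaleGroupoid A O} {K : EtaleGroupoid AK OK}
    {X Y : Type} [TopologicalSpace X] [TopologicalSpace Y]
    (CX : Correspondence H G X) (CY : Correspondence G K Y) :
    ∃ C : Correspondence H K (Comp CX CY),
      C.left.anchor = compAnchorR CX CY ∧
      C.right.anchor = compAnchorS CX CY ∧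
      (∀ z : { p : X × Y // CX.right.anchor p.1 = CY.left.anchor p.2 },
        ∀ h, ∀ hh : H.s h = CX.left.anchor z.1.1,
          C.left.act h (compMk CX CY z) =
            compMk CX CY ⟨(CX.left.act h z.1.1, z.1.2), by
              rw [CX.sInv_left _ _ hh]; exact z.2⟩) ∧
      (∀ z : { p : X × Y // CX.right.anchor p.1 = CY.left.anchor p.2 },
        ∀ k, ∀ hk : CY.right.anchor z.1.2 = K.r k,
          C.right.act (compMk CX CY z) k =
            compMk CX CY ⟨(z.1.1, CY.right.act z.1.2 k), by
              rw [CY.rInv_right _ _ hk]; exact z.2⟩) ∧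
      -- if `X` and `Y` are proper then so is the composite
      (IsProperMap CX.rStar → IsProperMap CY.rStar → IsProperMap C.rStar) ∧
      -- if `X` and `Y` are tight then so is the composite
      (IsHomeomorph CX.rStar → IsHomeomorph CY.rStar → IsHomeomorph C.rStar) := by
  exact ⟨CompAux.compC CX CY, rfl, rfl, fun z h hh => CompAux.lact_mk CX CY z h hh,
    fun z k hk => CompAux.ract_mk CX CY z k hk, CompAux.rStar_proper CX CY,
    CompAux.rStar_homeo CX CY⟩

end Statement13
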